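/- Let l ≥ 0 and 0 = i_0 < i_1 < … < i_l < i_{l+1} = k be fixed integers and T(n) := T_{[i_0,…,i_{l+1}]}(n; α). Then as n → ∞, 𝔼(T(n)) = n/M_n^{l+2} − (k − 2l − 3) n/M_n^{l+3} + O(n/M_n^{l+4}). -/

import Mathlib

open MeasureTheory Filter Finset Asymptotics
open scoped Classical

/-- `y_m(α) = ∏_{j ∈ α, j < m} (1 - 1/j)` (empty product = 1). -/
noncomputable def hawkinsY (A : Set ℕ) (m : ℕ) : ℝ :=
  ∏ j ∈ Finset.range m, if j ∈ A then 1 - 1 / (j : ℝ) else 1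

/-- The σ-algebra generated by the events `{j ∈ α}` for `2 ≤ j < m`. -/
def sieveSigma {Ω : Type*} (α : Ω → Set ℕ) (m : ℕ) : MeasurableSpace Ω :=
  MeasurableSpace.generateFrom {s | ∃ j : ℕ, 2 ≤ j ∧ j < m ∧ s = {ω | j ∈ α ω}}

/-- Wunderlich's model of the Hawkins random sieve: a probability space `(Ω, μ)` with a
random subset `α` of `{2,3,4,…}` such that `μ(2 ∈ α) = 1` and, for every `m ≥ 2`, the
conditional probability of `{m ∈ α}` given the σ-algebra generated by the events
`{j ∈ α}`, `2 ≤ j < m`, equals `y_m(α)`. -/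
structure IsHawkinsSieve {Ω : Type*} [MeasurableSpace Ω] (μ : Measure Ω)
    (α : Ω → Set ℕ) : Prop where
  isProb : IsProbabilityMeasure μ
  meas : ∀ n : ℕ, MeasurableSet {ω | n ∈ α ω}
  mem_ge_two : ∀ ω, ∀ n ∈ α ω, 2 ≤ n
  two_mem : μ {ω | 2 ∈ α ω} = 1
  condExp_mem : ∀ m : ℕ, 2 ≤ m →
    μ[Set.indicator {ω | m ∈ α ω} (fun _ => (1 : ℝ)) | sieveSigma α m]
      =ᵐ[μ] fun ω => hawkinsY (α ω) m

/-- `M_k = 1 + ∑_{j=1}^{k-2} 1/j` (so `M_2 = 1`). -/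
noncomputable def Mharm (k : ℕ) : ℝ := 1 + ∑ j ∈ Finset.Icc 1 (k - 2), 1 / (j : ℝ)

/-- `m[i_0,…,i_{l+1}] ∈ α`: for every `h ∈ [0, k]`, `m + h ∈ α` iff `h` is one of the
values `i_0, …, i_{l+1}`. -/
def patMem (A : Set ℕ) (l k : ℕ) (i : ℕ → ℕ) (m : ℕ) : Prop :=
  ∀ h : ℕ, h ≤ k → (m + h ∈ A ↔ ∃ j : ℕ, j ≤ l + 1 ∧ i j = h)

/-- `T_{[i_0,…,i_{l+1}]}(n; α) = #{m ≤ n : m[i_0,…,i_{l+1}] ∈ α}`. -/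
noncomputable def hawkinsT (A : Set ℕ) (l k : ℕ) (i : ℕ → ℕ) (n : ℕ) : ℕ :=
  ((Finset.range (n + 1)).filter fun m => patMem A l k i m).card

lemma Mharm_two : Mharm 2 = 1 := by simp [Mharm]

lemma Mharm_succ {m : ℕ} (hm : 2 ≤ m) : Mharm (m + 1) = Mharm m + 1 / ((m : ℝ) - 1) := by
  obtain ⟨n, rfl⟩ := Nat.exists_eq_add_of_le' hm
  simp only [Mharm, show n + 2 + 1 - 2 = n + 1 by omega, Nat.add_sub_cancel]
  rw [Finset.sum_Icc_succ_top (by omega)]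
  push_cast
  ring

lemma one_le_Mharm (m : ℕ) : 1 ≤ Mharm m := by
  unfold Mharm
  have : 0 ≤ ∑ j ∈ Finset.Icc 1 (m - 2), 1 / (j : ℝ) := Finset.sum_nonneg fun _ _ => by positivity
  linarith

lemma Mharm_pos (m : ℕ) : 0 < Mharm m := one_pos.trans_le (one_le_Mharm m)

lemma Mharm_le_two_add_log {m : ℕ} (hm : 1 ≤ m) : Mharm m ≤ 2 + Real.log m := by
  have h1 := harmonic_le_one_add_log m
  have h2 : ∑ j ∈ Finset.Icc 1 (m - 2), 1 / (j : ℝ) ≤ (harmonic m : ℝ) := by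
    rw [harmonic_eq_sum_Icc]
    push_cast
    simp only [one_div]
    exact Finset.sum_le_sum_of_subset_of_nonneg
      (Finset.Icc_subset_Icc_right (by omega)) fun _ _ _ => by positivity
  unfold Mharm
  linarith

lemma exists_Mharm_pow_le (r : ℕ) : ∃ K : ℝ, 0 < K ∧ ∀ m : ℕ, 1 ≤ m → Mharm m ^ r ≤ K * m := by
  refine ⟨((3 + r : ℕ) : ℝ) ^ (r + 1), by positivity, fun m hm => ?_⟩
  have hm1 : (1 : ℝ) ≤ m := by exact_mod_cast hm
  have hε : (0 : ℝ) < ((r + 1 : ℕ) : ℝ)⁻¹ := by positivity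
  have hlog := Real.log_le_rpow_div (x := m) (by positivity) hε
  set x : ℝ := (m : ℝ) ^ ((r + 1 : ℕ) : ℝ)⁻¹ with hx
  have hx1 : 1 ≤ x := Real.one_le_rpow hm1 hε.le
  have hxr : x ^ (r + 1) = m := Real.rpow_inv_natCast_pow (by positivity) (by omega)
  have hM : Mharm m ≤ ((3 + r : ℕ) : ℝ) * x := by
    have := Mharm_le_two_add_log hm
    rw [div_inv_eq_mul] at hlog
    push_cast at hlog ⊢
    nlinarith
  calc Mharm m ^ r ≤ Mharm m ^ (r + 1) := pow_le_pow_right₀ (one_le_Mharm m) (by omega)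
    _ ≤ (((3 + r : ℕ) : ℝ) * x) ^ (r + 1) := pow_le_pow_left₀ (Mharm_pos m).le hM _
    _ = _ := by rw [mul_pow, hxr]

/-- The remainder of the first-order expansion of `v ↦ v⁻ᵖ` at `1`, divided by `(v - 1)²`, as a
polynomial in `u = v⁻¹`. -/
noncomputable def invRem : ℕ → ℝ → ℝ
  | 0, _ => 0
  | p + 1, u => u * invRem p u + (p + 1) * u

lemma pow_eq_add_invRem (p : ℕ) {u : ℝ} (hu : u ≠ 0) :
    u ^ p = 1 - p * (u⁻¹ - 1) + (u⁻¹ - 1) ^ 2 * invRem p u := by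
  induction p with
  | zero => simp [invRem]
  | succ p ih =>
    rw [pow_succ, ih, invRem]
    push_cast
    field_simp
    ring

lemma invRem_nonneg (p : ℕ) {u : ℝ} (hu : 0 ≤ u) : 0 ≤ invRem p u := by
  induction p with
  | zero => simp [invRem]
  | succ p ih => rw [invRem]; positivity

lemma invRem_mono (p : ℕ) {u v : ℝ} (hu : 0 ≤ u) (huv : u ≤ v) : invRem p u ≤ invRem p v := by
  induction p with
  | zero => simp [invRem]
  | succ p ih =>
    rw [invRem, invRem]
    have := invRem_nonneg p hu
    gcongr
    exact hu.trans huv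

lemma inv_add_pow_bounds (p : ℕ) {M s : ℝ} (hM : 0 < M) (hs : 0 ≤ s) :
    M⁻¹ ^ p - p * s * M⁻¹ ^ (p + 1) ≤ (M + s)⁻¹ ^ p ∧
    (M + s)⁻¹ ^ p ≤ M⁻¹ ^ p - p * s * M⁻¹ ^ (p + 1) + invRem p 1 * s ^ 2 * M⁻¹ ^ (p + 2) := by
  have hMs : 0 < M + s := by linarith
  have hu : 0 < M / (M + s) := div_pos hM hMs
  have key := pow_eq_add_invRem p hu.ne'
  have h1 : (M / (M + s))⁻¹ - 1 = s * M⁻¹ := by field_simp; ring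
  have h2 : (M + s)⁻¹ ^ p = M⁻¹ ^ p * (M / (M + s)) ^ p := by
    rw [← mul_pow]; congr 1; field_simp
  have hR0 := invRem_nonneg p hu.le
  have hR1 := invRem_mono p hu.le (show M / (M + s) ≤ 1 by rw [div_le_one hMs]; linarith)
  rw [h2, key, h1]
  set R := invRem p (M / (M + s))
  have e : M⁻¹ ^ p * (1 - p * (s * M⁻¹) + (s * M⁻¹) ^ 2 * R) =
    M⁻¹ ^ p - p * s * M⁻¹ ^ (p + 1) + R * s ^ 2 * M⁻¹ ^ (p + 2) := by ring
  rw [e]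
  have hpos : 0 ≤ R * s ^ 2 * M⁻¹ ^ (p + 2) := by positivity
  refine ⟨by linarith, ?_⟩
  gcongr

/-- A lower bound for `y ^ (p + 1)` in terms of `y ^ p`, `y⁻¹` and `y⁻²`, with equality at
`y = t`. -/
lemma mul_pow_sub_pow_succ_le (p : ℕ) {A t y : ℝ} (hA : 0 ≤ A) (ht : 0 < t) (hy : 0 < y) :
    A * t * y ^ p - y ^ (p + 1) ≤ t ^ (p + 1) * ((A - 1) + (p + 1 - A * p) * (t * y⁻¹ - 1) +
      A * invRem p A * (t * y⁻¹ - 1) ^ 2) := by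
  have hu : 0 < y / t := div_pos hy ht
  have k1 := pow_eq_add_invRem p hu.ne'
  have k2 := pow_eq_add_invRem (p + 1) hu.ne'
  have hinv : (y / t)⁻¹ = t * y⁻¹ := by rw [inv_div, div_eq_mul_inv]
  rw [hinv] at k1 k2
  have hbound : A * invRem p (y / t) - invRem (p + 1) (y / t) ≤ A * invRem p A := by
    rw [invRem]
    have h0 := invRem_nonneg p hu.le
    have h0A := invRem_nonneg p hA
    rcases le_total (y / t) A with hle | hle
    · have := mul_le_mul_of_nonneg_left (invRem_mono p hu.le hle) hA
      have : 0 ≤ y / t * invRem p (y / t) + (p + 1) * (y / t) := by positivity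
      linarith
    · have := mul_le_mul_of_nonneg_right hle h0
      have : 0 ≤ (p + 1) * (y / t) := by positivity
      have : 0 ≤ A * invRem p A := by positivity
      linarith
  have e : A * t * y ^ p - y ^ (p + 1) = t ^ (p + 1) * (A * (y / t) ^ p - (y / t) ^ (p + 1)) := by
    calc A * t * y ^ p - y ^ (p + 1) = A * t * (t * (y / t)) ^ p - (t * (y / t)) ^ (p + 1) := by
          rw [mul_div_cancel₀ _ ht.ne']
      _ = _ := by rw [mul_pow, mul_pow]; ring
  rw [e]
  refine mul_le_mul_of_nonneg_left ?_ (by positivity)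
  have := mul_le_mul_of_nonneg_left hbound (sq_nonneg (t * y⁻¹ - 1))
  rw [k1, k2]
  push_cast
  linarith

lemma one_sub_pow_le (p : ℕ) {x : ℝ} (hx0 : 0 ≤ x) (hx1 : x ≤ 1) :
    (1 - x) ^ p ≤ 1 - p * x + p ^ 2 * x ^ 2 := by
  induction p with
  | zero => simp
  | succ p ih =>
    rw [pow_succ]
    have := mul_le_mul_of_nonneg_right ih (sub_nonneg.2 hx1)
    refine this.trans ?_
    push_cast
    have h1 : (0 : ℝ) ≤ p := p.cast_nonneg
    have h2 : 0 ≤ (p : ℝ) * x ^ 2 := by positivity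
    have h3 : 0 ≤ (p : ℝ) ^ 2 * x ^ 3 := by positivity
    nlinarith [sq_nonneg x]

lemma inv_Mharm_pow_isBigO {p q : ℕ} (hpq : p ≤ q) :
    (fun m : ℕ => (Mharm m)⁻¹ ^ q) =O[atTop] fun m : ℕ => (Mharm m)⁻¹ ^ p := by
  refine IsBigO.of_bound 1 (Eventually.of_forall fun m => ?_)
  have h0 := inv_pos.2 (Mharm_pos m)
  rw [Real.norm_of_nonneg (by positivity), Real.norm_of_nonneg (by positivity), one_mul]
  exact pow_le_pow_of_le_one h0.le (inv_le_one_of_one_le₀ (one_le_Mharm m)) hpq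

lemma tendsto_inv_Mharm : Tendsto (fun m => (Mharm m)⁻¹) atTop (nhds 0) := by
  refine Tendsto.inv_tendsto_atTop ((tendsto_add_atTop_iff_nat 2).1 ?_)
  have : ∀ n : ℕ, Mharm (n + 2) = 1 + ∑ j ∈ Finset.range n, 1 / ((j : ℝ) + 1) := fun n => by
    rw [Mharm, Nat.add_sub_cancel, ← Finset.Ico_add_one_right_eq_Icc, Finset.sum_Ico_eq_sum_range]
    simp [add_comm]
  simp only [this]
  exact tendsto_atTop_add_const_left _ _ Real.tendsto_sum_range_one_div_nat_succ_atTop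

lemma Mharm_le_sub_one {m : ℕ} (hm : 2 ≤ m) : Mharm m ≤ m - 1 := by
  induction m, hm using Nat.le_induction with
  | base => rw [Mharm_two]; norm_num
  | succ m hm ih =>
    have hm2 : (2 : ℝ) ≤ m := by exact_mod_cast hm
    have : 1 / ((m : ℝ) - 1) ≤ 1 := by rw [div_le_one] <;> linarith
    rw [Mharm_succ hm]
    push_cast
    linarith

lemma inv_Mharm_succ_pow_sub_isBigO (r : ℕ) :
    (fun n : ℕ => (Mharm (n + 1))⁻¹ ^ r - (Mharm n)⁻¹ ^ r) =O[atTop]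
      fun n : ℕ => (Mharm n)⁻¹ ^ (r + 2) := by
  refine IsBigO.of_bound r ?_
  filter_upwards [eventually_ge_atTop 2] with n hn
  have hn2 : (2 : ℝ) ≤ n := by exact_mod_cast hn
  have hM := Mharm_pos n
  have hs0 : 0 ≤ 1 / ((n : ℝ) - 1) := one_div_nonneg.2 (by linarith)
  have hst : 1 / ((n : ℝ) - 1) ≤ (Mharm n)⁻¹ := by
    rw [one_div]; exact inv_anti₀ hM (Mharm_le_sub_one hn)
  have hb := (inv_add_pow_bounds r hM hs0).1
  have hle : (Mharm n + 1 / ((n : ℝ) - 1))⁻¹ ^ r ≤ (Mharm n)⁻¹ ^ r := by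
    gcongr
    linarith
  rw [Mharm_succ hn, Real.norm_of_nonpos (by linarith), Real.norm_of_nonneg (by positivity)]
  have : r * (1 / ((n : ℝ) - 1)) * (Mharm n)⁻¹ ^ (r + 1) ≤
      r * (Mharm n)⁻¹ * (Mharm n)⁻¹ ^ (r + 1) := by gcongr
  have e : r * (Mharm n)⁻¹ * (Mharm n)⁻¹ ^ (r + 1) = r * (Mharm n)⁻¹ ^ (r + 2) := by ring
  linarith

/-- The increments of `n / M_n ^ r`, to second order. -/
lemma mul_inv_Mharm_pow_succ_sub_isBigO (r : ℕ) :
    (fun n : ℕ => ((n + 1 : ℕ) : ℝ) * (Mharm (n + 1))⁻¹ ^ r - n * (Mharm n)⁻¹ ^ r -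
        ((Mharm n)⁻¹ ^ r - r * (Mharm n)⁻¹ ^ (r + 1))) =O[atTop]
      fun n : ℕ => (Mharm n)⁻¹ ^ (r + 2) := by
  refine IsBigO.of_bound (2 * r + 3 * invRem r 1) ?_
  filter_upwards [eventually_ge_atTop 2] with n hn
  have hn2 : (2 : ℝ) ≤ n := by exact_mod_cast hn
  have hM := Mharm_pos n
  have hst : 1 / ((n : ℝ) - 1) ≤ (Mharm n)⁻¹ := by
    rw [one_div]; exact inv_anti₀ hM (Mharm_le_sub_one hn)
  have ht1 : (Mharm n)⁻¹ ≤ 1 := inv_le_one_of_one_le₀ (one_le_Mharm n)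
  have ht0 := inv_pos.2 hM
  have hs0 : 0 ≤ 1 / ((n : ℝ) - 1) := one_div_nonneg.2 (by linarith)
  obtain ⟨hb1, hb2⟩ := inv_add_pow_bounds r hM hs0
  rw [Mharm_succ hn]
  have hns : ((n : ℝ) + 1) * (1 / ((n : ℝ) - 1)) = 1 + 2 * (1 / ((n : ℝ) - 1)) := by
    have : (n : ℝ) - 1 ≠ 0 := by linarith
    field_simp
    ring
  have hR := invRem_nonneg r zero_le_one
  set s := 1 / ((n : ℝ) - 1)
  set t := (Mharm n)⁻¹
  set t' := (Mharm n + s)⁻¹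
  set R := invRem r 1
  set δ := t' ^ r - (t ^ r - r * s * t ^ (r + 1)) with hδ
  have hδ0 : 0 ≤ δ := by linarith
  have hδ1 : δ ≤ R * s ^ 2 * t ^ (r + 2) := by linarith
  have e : ((n + 1 : ℕ) : ℝ) * t' ^ r - n * t ^ r - (t ^ r - r * t ^ (r + 1)) =
      ((n : ℝ) + 1) * δ - 2 * r * (s * t ^ (r + 1)) := by
    rw [hδ]
    push_cast
    linear_combination (-(r : ℝ)) * t ^ (r + 1) * hns
  have hb : ((n : ℝ) + 1) * δ ≤ 3 * R * t ^ (r + 2) := by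
    calc ((n : ℝ) + 1) * δ ≤ ((n : ℝ) + 1) * (R * s ^ 2 * t ^ (r + 2)) := by gcongr
      _ = (1 + 2 * s) * s * (R * t ^ (r + 2)) := by rw [← hns]; ring
      _ ≤ 3 * (R * t ^ (r + 2)) := by
        refine mul_le_mul_of_nonneg_right ?_ (by positivity)
        have : s ≤ 1 := hst.trans ht1
        nlinarith
      _ = _ := by ring
  have hc : s * t ^ (r + 1) ≤ t ^ (r + 2) := by
    calc s * t ^ (r + 1) ≤ t * t ^ (r + 1) := by gcongr
      _ = _ := by ring
  have hc' := mul_le_mul_of_nonneg_left hc (show (0 : ℝ) ≤ 2 * r by positivity)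
  have hp1 : 0 ≤ ((n : ℝ) + 1) * δ := by positivity
  have hp2 : 0 ≤ 2 * (r : ℝ) * (s * t ^ (r + 1)) := by positivity
  have hp3 : 0 ≤ 3 * R * t ^ (r + 2) := by positivity
  rw [e, Real.norm_eq_abs, Real.norm_of_nonneg (by positivity), abs_le]
  constructor <;> linarith

/-- A sequence with increments `O(M_n⁻ʳ)` is `O(n M_n⁻ʳ)`. -/
lemma isBigO_of_succ_sub_isBigO {D : ℕ → ℝ} (r : ℕ)
    (hD : (fun n => D (n + 1) - D n) =O[atTop] fun n => (Mharm n)⁻¹ ^ r) :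
    D =O[atTop] fun n : ℕ => (n : ℝ) * (Mharm n)⁻¹ ^ r := by
  obtain ⟨C, hC⟩ := hD.bound
  obtain ⟨C₁, hC₁⟩ := (mul_inv_Mharm_pow_succ_sub_isBigO r).bound
  have hlim : Tendsto (fun n => r * (Mharm n)⁻¹ + C₁ * (Mharm n)⁻¹ ^ 2) atTop (nhds 0) := by
    simpa using (tendsto_inv_Mharm.const_mul (r : ℝ)).add ((tendsto_inv_Mharm.pow 2).const_mul C₁)
  obtain ⟨n₀, hn₀⟩ := eventually_atTop.1
    (((hC.and hC₁).and (hlim.eventually_lt_const one_half_pos)).and (eventually_ge_atTop 1))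
  have hF : ∀ n, n₀ ≤ n → 0 < (n : ℝ) * (Mharm n)⁻¹ ^ r := fun n hn => by
    have := inv_pos.2 (Mharm_pos n)
    have : (0 : ℝ) < n := by exact_mod_cast (hn₀ n hn).2
    positivity
  set C₂ := max (2 * C) (|D n₀| / (n₀ * (Mharm n₀)⁻¹ ^ r)) with hC₂
  have hC₂0 : 0 ≤ C₂ := le_max_of_le_right (div_nonneg (abs_nonneg _) (hF n₀ le_rfl).le)
  refine IsBigO.of_bound C₂ (eventually_atTop.2 ⟨n₀, fun n hn => ?_⟩)
  rw [Real.norm_eq_abs, Real.norm_of_nonneg (hF n hn).le]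
  induction n, hn using Nat.le_induction with
  | base => exact (div_le_iff₀ (hF n₀ le_rfl)).1 (le_max_right _ _)
  | succ n hn ih =>
    obtain ⟨⟨⟨h1, h2⟩, h3⟩, -⟩ := hn₀ n hn
    have ht := inv_pos.2 (Mharm_pos n)
    rw [Real.norm_eq_abs, Real.norm_of_nonneg (by positivity)] at h1 h2
    have h2' := (abs_le.1 h2).1
    set t := (Mharm n)⁻¹
    have hhalf : t ^ r * (1 / 2) ≤
        ((n + 1 : ℕ) : ℝ) * (Mharm (n + 1))⁻¹ ^ r - n * t ^ r := by
      have := mul_le_mul_of_nonneg_left h3.le (show 0 ≤ t ^ r by positivity)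
      have e : t ^ r * (r * t + C₁ * t ^ 2) = r * t ^ (r + 1) + C₁ * t ^ (r + 2) := by ring
      linarith
    have hCt : C * t ^ r ≤ C₂ * (t ^ r * (1 / 2)) := by
      have := mul_le_mul_of_nonneg_right (le_max_left (2 * C) (|D n₀| / (n₀ * (Mharm n₀)⁻¹ ^ r)))
        (show 0 ≤ t ^ r * (1 / 2) by positivity)
      linarith
    have hmul := mul_le_mul_of_nonneg_left hhalf hC₂0
    have htri := abs_add_le (D (n + 1) - D n) (D n)
    rw [sub_add_cancel] at htri
    linarith

/-- Estimates for the coefficient `1 - (1 - 1/m) ^ p` in the moment recursion, with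
`s = 1/(m-1)`. -/
lemma one_sub_one_sub_pow_bounds {p : ℕ} (hp : 1 ≤ p) {x s : ℝ} (hx0 : 0 < x) (hx1 : x ≤ 1 / 2)
    (hxs : x = s - x * s) :
    s / 2 ≤ 1 - (1 - x) ^ p ∧ 1 - (1 - x) ^ p ≤ p * s ∧
      p * s - (1 - (1 - x) ^ p) ≤ (p + p ^ 2) * s ^ 2 := by
  have hs0 : 0 < s := by nlinarith
  have hp1 : (1 : ℝ) ≤ p := by exact_mod_cast hp
  have hxle : x ≤ s := by nlinarith
  have hxhalf : s / 2 ≤ x := by nlinarith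
  refine ⟨?_, ?_, ?_⟩
  · have := pow_le_of_le_one (show 0 ≤ 1 - x by linarith) (by linarith) (show p ≠ 0 by omega)
    linarith
  · have := one_add_mul_le_pow (show (-2 : ℝ) ≤ -x by linarith) p
    rw [← sub_eq_add_neg] at this
    nlinarith
  · have := one_sub_pow_le p hx0.le (by linarith)
    have h1 : x ^ 2 ≤ s ^ 2 := pow_le_pow_left₀ hx0.le hxle 2
    have h2 : x * s ≤ s ^ 2 := by nlinarith
    have h3 : (p : ℝ) * s - p * x = p * (x * s) := by linear_combination (-(p : ℝ)) * hxs
    have h4 := mul_le_mul_of_nonneg_left h1 (show (0 : ℝ) ≤ p ^ 2 by positivity)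
    have h5 := mul_le_mul_of_nonneg_left h2 (show (0 : ℝ) ≤ p by positivity)
    linarith

/-- The induction step for the bound `a ≤ t ^ p + C t ^ (p + 2)` on the moments. -/
lemma moment_step_le {p : ℕ} {A C E K a a₁ c s t : ℝ} (hA : A = 2 * (p + 3)) (hC0 : 0 ≤ C)
    (hC : (p + p ^ 2) * (2 * K) + p * E ≤ C) (hE : 0 ≤ E) (hs : 0 < s) (ht : 0 < t)
    (hst : s ≤ 2 * K * t ^ 2) (hc1 : s / 2 ≤ c) (hc2 : c ≤ p * s)
    (hc3 : p * s - c ≤ (p + p ^ 2) * s ^ 2) (hcA : c * A * t ≤ 1)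
    (ha : a ≤ t ^ p + C * t ^ (p + 2))
    (ha₁ : A * t * a - (A - 1) * t ^ (p + 1) - E * t ^ (p + 3) ≤ a₁) :
    a - c * a₁ ≤
      t ^ p - p * s * t ^ (p + 1) + C * (t ^ (p + 2) - (p + 2) * s * t ^ (p + 3)) := by
  have hc0 : 0 ≤ c := by linarith
  have hT : 0 ≤ t ^ (p + 3) := by positivity
  have g1 : a - c * a₁ ≤
      a * (1 - c * A * t) + c * (A - 1) * t ^ (p + 1) + c * E * t ^ (p + 3) := by
    have := mul_le_mul_of_nonneg_left ha₁ hc0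
    linarith
  have g2 : a * (1 - c * A * t) ≤ (t ^ p + C * t ^ (p + 2)) * (1 - c * A * t) :=
    mul_le_mul_of_nonneg_right ha (by linarith)
  have g3 : (p * s - c) * t ^ (p + 1) ≤ (p + p ^ 2) * (2 * K) * s * t ^ (p + 3) := by
    calc (p * s - c) * t ^ (p + 1) ≤ (p + p ^ 2) * s ^ 2 * t ^ (p + 1) := by gcongr
      _ = (p + p ^ 2) * s * s * t ^ (p + 1) := by ring
      _ ≤ (p + p ^ 2) * s * (2 * K * t ^ 2) * t ^ (p + 1) := by gcongr
      _ = _ := by ring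
  have g4 : c * E * t ^ (p + 3) ≤ p * s * E * t ^ (p + 3) := by gcongr
  have g5 : C * ((p + 3) * s) * t ^ (p + 3) ≤ C * (c * A) * t ^ (p + 3) := by
    refine mul_le_mul_of_nonneg_right (mul_le_mul_of_nonneg_left ?_ hC0) hT
    have := mul_le_mul_of_nonneg_right hc1 (show (0 : ℝ) ≤ 2 * (p + 3) by positivity)
    rw [hA]
    linarith
  have g6 : ((p + p ^ 2) * (2 * K) + p * E) * (s * t ^ (p + 3)) ≤ C * (s * t ^ (p + 3)) := by
    gcongr
  have e1 : (t ^ p + C * t ^ (p + 2)) * (1 - c * A * t) = t ^ p - c * A * t ^ (p + 1) +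
    C * t ^ (p + 2) - C * (c * A) * t ^ (p + 3) := by ring
  rw [e1] at g2
  linarith

lemma hawkinsY_succ (A : Set ℕ) (m : ℕ) :
    hawkinsY A (m + 1) = hawkinsY A m * if m ∈ A then 1 - 1 / (m : ℝ) else 1 := by
  simp [hawkinsY, Finset.prod_range_succ]

lemma finite_range_hawkinsY (m : ℕ) : (Set.range fun A : Set ℕ => hawkinsY A m).Finite := by
  refine (Set.finite_range fun s : (Finset.range m).powerset =>
    ∏ j ∈ Finset.range m, if j ∈ s.1 then 1 - 1 / (j : ℝ) else 1).subset ?_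
  rintro _ ⟨A, rfl⟩
  refine ⟨⟨(Finset.range m).filter (· ∈ A), by simp⟩, ?_⟩
  refine Finset.prod_congr rfl fun j hj => ?_
  simp [Finset.mem_range.1 hj]

lemma hawkinsY_two {A : Set ℕ} (hA : ∀ n ∈ A, 2 ≤ n) : hawkinsY A 2 = 1 := by
  refine Finset.prod_eq_one fun j hj => if_neg fun hjA => ?_
  have := hA j hjA
  simp at hj
  omega

lemma hawkinsY_pos {A : Set ℕ} (hA : ∀ n ∈ A, 2 ≤ n) (m : ℕ) : 0 < hawkinsY A m := by
  refine Finset.prod_pos fun j _ => ?_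
  split_ifs with hj
  · have h2 : (2 : ℝ) ≤ j := by exact_mod_cast hA j hj
    rw [sub_pos, div_lt_one (by linarith)]
    linarith
  · exact one_pos

lemma hawkinsY_succ_le {A : Set ℕ} (hA : ∀ n ∈ A, 2 ≤ n) (m : ℕ) :
    hawkinsY A (m + 1) ≤ hawkinsY A m := by
  rw [hawkinsY_succ]
  refine mul_le_of_le_one_right (hawkinsY_pos hA m).le ?_
  split_ifs
  · simp
  · rfl

lemma hawkinsY_le_one {A : Set ℕ} (hA : ∀ n ∈ A, 2 ≤ n) (m : ℕ) : hawkinsY A m ≤ 1 := by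
  induction m with
  | zero => simp [hawkinsY]
  | succ m ih => exact (hawkinsY_succ_le hA m).trans ih

lemma abs_hawkinsY_add_sub_le {A : Set ℕ} (hA : ∀ n ∈ A, 2 ≤ n) {m : ℕ} (hm : 1 ≤ m) (d : ℕ) :
    |hawkinsY A (m + d) - hawkinsY A m| ≤ d / m := by
  induction d with
  | zero => simp
  | succ d ih =>
    have hstep : |hawkinsY A (m + d + 1) - hawkinsY A (m + d)| ≤ 1 / m := by
      rw [hawkinsY_succ]
      have hy0 := hawkinsY_pos hA (m + d)
      have hy1 := hawkinsY_le_one hA (m + d)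
      split_ifs
      · have hle : 1 / ((m + d : ℕ) : ℝ) ≤ 1 / m :=
          one_div_le_one_div_of_le (by exact_mod_cast hm) (by push_cast; simp)
        have hn : 0 ≤ 1 / ((m + d : ℕ) : ℝ) := by positivity
        rw [show hawkinsY A (m + d) * (1 - 1 / ((m + d : ℕ) : ℝ)) - hawkinsY A (m + d)
          = -(hawkinsY A (m + d) * (1 / ((m + d : ℕ) : ℝ))) by ring, abs_neg, abs_of_nonneg
          (by positivity)]
        nlinarith
      · simp
    calc |hawkinsY A (m + d + 1) - hawkinsY A m|
        ≤ |hawkinsY A (m + d + 1) - hawkinsY A (m + d)| + |hawkinsY A (m + d) - hawkinsY A m| :=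
          abs_sub_le _ _ _
      _ ≤ 1 / m + d / m := add_le_add hstep ih
      _ = ((d + 1 : ℕ) : ℝ) / m := by push_cast; ring

section Sieve

variable {Ω : Type*} {α : Ω → Set ℕ}

/-- The indicator of `{j ∈ α}` as a real random variable. -/
noncomputable def memInd (α : Ω → Set ℕ) (j : ℕ) (ω : Ω) : ℝ := if j ∈ α ω then 1 else 0

lemma abs_memInd_le (j : ℕ) (ω : Ω) : |memInd α j ω| ≤ 1 := by
  unfold memInd; split_ifs <;> simp

lemma sieveSigma_mono {m n : ℕ} (hmn : m ≤ n) : sieveSigma α m ≤ sieveSigma α n :=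
  MeasurableSpace.generateFrom_mono fun _ ⟨j, hj2, hj, hs⟩ => ⟨j, hj2, hj.trans_le hmn, hs⟩

lemma exists_bound_comp_hawkinsY (φ : ℝ → ℝ) (m : ℕ) :
    ∃ c, ∀ ω, |φ (hawkinsY (α ω) m)| ≤ c := by
  obtain ⟨c, hc⟩ := ((finite_range_hawkinsY m).image fun y => |φ y|).bddAbove
  exact ⟨c, fun ω => hc ⟨_, ⟨α ω, rfl⟩, rfl⟩⟩

namespace IsHawkinsSieve

variable [mΩ : MeasurableSpace Ω] {μ : Measure Ω} (h : IsHawkinsSieve μ α)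
include h

lemma sieveSigma_le (m : ℕ) : sieveSigma α m ≤ mΩ := by
  refine MeasurableSpace.generateFrom_le ?_
  rintro _ ⟨j, -, -, rfl⟩
  exact h.meas j

lemma measurableSet_mem {j m : ℕ} (hj : j < m) : MeasurableSet[sieveSigma α m] {ω | j ∈ α ω} := by
  by_cases h2 : 2 ≤ j
  · exact MeasurableSpace.measurableSet_generateFrom ⟨j, h2, hj, rfl⟩
  · have : {ω | j ∈ α ω} = ∅ := by
      ext ω
      simpa using fun hjω => h2 (h.mem_ge_two ω j hjω)
    rw [this]
    exact @MeasurableSet.empty _ (sieveSigma α m)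

lemma measurable_memInd {j m : ℕ} (hj : j < m) : Measurable[sieveSigma α m] (memInd α j) :=
  Measurable.ite (h.measurableSet_mem hj) measurable_const measurable_const

lemma measurable_hawkinsY (m : ℕ) : Measurable[sieveSigma α m] fun ω => hawkinsY (α ω) m := by
  refine Finset.measurable_fun_prod _ fun j hj => ?_
  exact Measurable.ite (h.measurableSet_mem (Finset.mem_range.1 hj)) measurable_const
    measurable_const

/-- A bounded function of the past integrates against `{m ∈ α}` as against `y_m`. -/
lemma integral_mul_memInd {m : ℕ} (hm : 2 ≤ m) {f : Ω → ℝ} (hf : Measurable[sieveSigma α m] f)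
    {c : ℝ} (hc : ∀ ω, |f ω| ≤ c) :
    ∫ ω, f ω * memInd α m ω ∂μ = ∫ ω, f ω * hawkinsY (α ω) m ∂μ := by
  have := h.isProb
  have hI : Set.indicator {ω | m ∈ α ω} (fun _ => (1 : ℝ)) = memInd α m := by
    ext ω; simp [memInd, Set.indicator]
  have hint : Integrable (memInd α m) μ := by
    rw [← hI]
    exact (integrable_const _).indicator (h.meas m)
  have hpull := condExp_stronglyMeasurable_mul_of_bound (μ := μ) (h.sieveSigma_le m)
    (hf.stronglyMeasurable) hint c (ae_of_all _ hc)
  have hcond := h.condExp_mem m hm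
  rw [hI] at hcond
  rw [← integral_condExp (h.sieveSigma_le m) (f := fun ω => f ω * memInd α m ω)]
  refine integral_congr_ae ?_
  filter_upwards [hpull, hcond] with ω h1 h2
  rw [← h2]
  exact h1

lemma integrable_comp {φ : ℝ → ℝ} (hφ : Measurable φ) (m : ℕ) :
    Integrable (fun ω => φ (hawkinsY (α ω) m)) μ := by
  have := h.isProb
  obtain ⟨c, hc⟩ := exists_bound_comp_hawkinsY (α := α) φ m
  exact .of_bound (hφ.comp ((h.measurable_hawkinsY m).mono (h.sieveSigma_le m) le_rfl)
    ).aestronglyMeasurable c (ae_of_all _ hc)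

/-- The one-step transition of the process `y_m`. -/
lemma integral_comp_succ {φ : ℝ → ℝ} (hφ : Measurable φ) {m : ℕ} (hm : 2 ≤ m) :
    ∫ ω, φ (hawkinsY (α ω) (m + 1)) ∂μ =
      ∫ ω, (φ (hawkinsY (α ω) m) + hawkinsY (α ω) m *
        (φ ((1 - 1 / (m : ℝ)) * hawkinsY (α ω) m) - φ (hawkinsY (α ω) m))) ∂μ := by
  have := h.isProb
  set ψ : ℝ → ℝ := fun y => φ ((1 - 1 / (m : ℝ)) * y) - φ y with hψ
  have hψm : Measurable ψ := (hφ.comp (measurable_const.mul measurable_id)).sub hφ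
  obtain ⟨c, hc⟩ := exists_bound_comp_hawkinsY (α := α) ψ m
  have hmeas : Measurable[sieveSigma α m] fun ω => ψ (hawkinsY (α ω) m) :=
    hψm.comp (h.measurable_hawkinsY m)
  have hkey := h.integral_mul_memInd hm hmeas hc
  have hY := h.integrable_comp hφ m
  have hI1 : Integrable (fun ω => ψ (hawkinsY (α ω) m) * memInd α m ω) μ :=
    (h.integrable_comp hψm m).mul_bdd (c := 1)
      ((h.measurable_memInd (Nat.lt_succ_self m)).mono (h.sieveSigma_le _) le_rfl
        ).aestronglyMeasurable (ae_of_all _ fun ω => abs_memInd_le m ω)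
  have hI2 : Integrable (fun ω => ψ (hawkinsY (α ω) m) * hawkinsY (α ω) m) μ :=
    h.integrable_comp (φ := fun y => ψ y * y) (hψm.mul measurable_id) m
  calc ∫ ω, φ (hawkinsY (α ω) (m + 1)) ∂μ
      = ∫ ω, (φ (hawkinsY (α ω) m) + ψ (hawkinsY (α ω) m) * memInd α m ω) ∂μ := by
        refine integral_congr_ae (ae_of_all _ fun ω => ?_)
        simp only [hawkinsY_succ, memInd, hψ]
        split_ifs
        · rw [mul_comm]; ring
        · simp
    _ = ∫ ω, (φ (hawkinsY (α ω) m) + ψ (hawkinsY (α ω) m) * hawkinsY (α ω) m) ∂μ := by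
        rw [integral_add hY hI1, integral_add hY hI2, hkey]
    _ = _ := by simp only [mul_comm, hψ]

lemma pos (m : ℕ) (ω : Ω) : 0 < hawkinsY (α ω) m := hawkinsY_pos (h.mem_ge_two ω) m

lemma le_one (m : ℕ) (ω : Ω) : hawkinsY (α ω) m ≤ 1 := hawkinsY_le_one (h.mem_ge_two ω) m

lemma integral_comp_two (φ : ℝ → ℝ) : ∫ ω, φ (hawkinsY (α ω) 2) ∂μ = φ 1 := by
  have := h.isProb
  simp [fun ω => hawkinsY_two (h.mem_ge_two ω)]

/-- The conditional law of a block of consecutive memberships is, up to `O(1/m)`, that of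
independent trials with success probability `y_m`. -/
lemma abs_integral_mul_prod_sub_le (p : ℕ → Prop) {m : ℕ} (hm : 2 ≤ m) (H : ℕ) {g : Ω → ℝ}
    (hg : Measurable[sieveSigma α m] g) (hg1 : ∀ ω, |g ω| ≤ 1) :
    |∫ ω, g ω * ∏ d ∈ Finset.range H,
          (if p d then memInd α (m + d) ω else 1 - memInd α (m + d) ω) ∂μ -
        ∫ ω, g ω * ∏ d ∈ Finset.range H,
          (if p d then hawkinsY (α ω) m else 1 - hawkinsY (α ω) m) ∂μ| ≤ (H : ℝ) ^ 2 / m := by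
  have := h.isProb
  induction H generalizing g with
  | zero => simp
  | succ H ih =>
    set w : ℝ → ℝ := fun x => if p H then x else 1 - x with hw
    have hwm : Measurable w := by
      by_cases hp : p H <;> simp only [hw, hp, if_true, if_false] <;> fun_prop
    have hw1 : ∀ x, 0 ≤ x → x ≤ 1 → |w x| ≤ 1 := by
      intro x h0 h1
      simp only [hw, abs_le]
      split_ifs <;> constructor <;> linarith
    have hwsub : ∀ x y, |w x - w y| = |x - y| := by
      intro x y
      simp only [hw]
      split_ifs
      · rfl
      · rw [abs_sub_comm x y]; congr 1; ring
    have hX0 : ∀ j ω, 0 ≤ memInd α j ω ∧ memInd α j ω ≤ 1 := by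
      intro j ω; unfold memInd; split_ifs <;> simp
    set Q : Ω → ℝ := fun ω => ∏ d ∈ Finset.range H,
      (if p d then memInd α (m + d) ω else 1 - memInd α (m + d) ω) with hQ
    set R : Ω → ℝ := fun ω => ∏ d ∈ Finset.range H,
      (if p d then hawkinsY (α ω) m else 1 - hawkinsY (α ω) m) with hR
    have hQm : Measurable[sieveSigma α (m + H)] Q := by
      refine Finset.measurable_fun_prod _ fun d hd => ?_
      have := h.measurable_memInd (j := m + d) (m := m + H) (by simpa using hd)
      split_ifs
      · exact this
      · exact measurable_const.sub this
    have hQ1 : ∀ ω, |Q ω| ≤ 1 := by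
      intro ω
      rw [hQ, Finset.abs_prod]
      refine Finset.prod_le_one (fun _ _ => abs_nonneg _) fun d _ => ?_
      have := hX0 (m + d) ω
      split_ifs <;> rw [abs_le] <;> constructor <;> linarith
    have hgQ : Measurable[sieveSigma α (m + H)] fun ω => g ω * Q ω :=
      (hg.mono (sieveSigma_mono (Nat.le_add_right m H)) le_rfl).mul hQm
    have hgQ1 : ∀ ω, |g ω * Q ω| ≤ 1 := fun ω => by
      rw [abs_mul]; exact mul_le_one₀ (hg1 ω) (abs_nonneg _) (hQ1 ω)
    have hint : ∀ {f : Ω → ℝ}, Measurable f → (∀ ω, |f ω| ≤ 1) →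
        Integrable (fun ω => g ω * Q ω * f ω) μ := fun {f} hf hf1 =>
      .of_bound ((hgQ.mono (h.sieveSigma_le _) le_rfl).mul hf).aestronglyMeasurable 1
        (ae_of_all _ fun ω => by
          rw [Real.norm_eq_abs, abs_mul]; exact mul_le_one₀ (hgQ1 ω) (abs_nonneg _) (hf1 ω))
    have hXm : Measurable (memInd α (m + H)) :=
      (h.measurable_memInd (Nat.lt_succ_self _)).mono (h.sieveSigma_le _) le_rfl
    have hYm : ∀ n, Measurable fun ω => hawkinsY (α ω) n := fun n =>
      (h.measurable_hawkinsY n).mono (h.sieveSigma_le _) le_rfl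
    have hY1 : ∀ n ω, |hawkinsY (α ω) n| ≤ 1 := fun n ω => by
      rw [abs_of_pos (h.pos n ω)]; exact h.le_one n ω
    have hI0 : Integrable (fun ω => g ω * Q ω) μ := by
      simpa using hint (f := fun _ => 1) measurable_const (by simp)
    have hstep : ∫ ω, g ω * Q ω * w (memInd α (m + H) ω) ∂μ =
        ∫ ω, g ω * Q ω * w (hawkinsY (α ω) (m + H)) ∂μ := by
      have hkey := h.integral_mul_memInd (m := m + H) (by omega) hgQ hgQ1
      by_cases hp : p H
      · simpa [hw, hp] using hkey
      · simp only [hw, hp, if_false, mul_sub, mul_one]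
        rw [integral_sub hI0 (hint hXm (abs_memInd_le _)),
          integral_sub hI0 (hint (hYm _) (hY1 _)), hkey]
    have hwY : ∀ n ω, |w (hawkinsY (α ω) n)| ≤ 1 := fun n ω =>
      hw1 _ (h.pos n ω).le (h.le_one n ω)
    have hwint : ∀ n, Integrable (fun ω => g ω * Q ω * w (hawkinsY (α ω) n)) μ := fun n =>
      hint (hwm.comp (hYm n)) (hwY n)
    have hreplace : |∫ ω, g ω * Q ω * w (hawkinsY (α ω) (m + H)) ∂μ -
        ∫ ω, g ω * Q ω * w (hawkinsY (α ω) m) ∂μ| ≤ H / m := by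
      rw [← integral_sub (hwint _) (hwint _)]
      have := norm_integral_le_of_norm_le_const (μ := μ) (C := H / m)
        (f := fun ω => g ω * Q ω * w (hawkinsY (α ω) (m + H)) -
          g ω * Q ω * w (hawkinsY (α ω) m)) (ae_of_all _ fun ω => by
            rw [← mul_sub, Real.norm_eq_abs, abs_mul, hwsub]
            exact (mul_le_of_le_one_left (abs_nonneg _) (hgQ1 ω)).trans
              (abs_hawkinsY_add_sub_le (h.mem_ge_two ω) (by omega) H))
      simpa using this
    have hih := ih (g := fun ω => g ω * w (hawkinsY (α ω) m))
      (hg.mul (hwm.comp (h.measurable_hawkinsY m))) fun ω => by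
        rw [abs_mul]; exact mul_le_one₀ (hg1 ω) (abs_nonneg _) (hwY m ω)
    have e1 : ∀ ω, g ω * w (hawkinsY (α ω) m) * Q ω = g ω * Q ω * w (hawkinsY (α ω) m) :=
      fun ω => by ring
    have e2 : ∀ ω, g ω * w (hawkinsY (α ω) m) * R ω = g ω * (R ω * w (hawkinsY (α ω) m)) :=
      fun ω => by ring
    simp only [hQ, hR] at e1 e2
    simp only [e1, e2] at hih
    simp only [Finset.prod_range_succ]
    change |∫ ω, g ω * (Q ω * w (memInd α (m + H) ω)) ∂μ -
      ∫ ω, g ω * (R ω * w (hawkinsY (α ω) m)) ∂μ| ≤ _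
    simp only [← mul_assoc] at hih ⊢
    rw [hstep]
    have hm0 : (0 : ℝ) < m := by exact_mod_cast (by omega : 0 < m)
    calc _ ≤ _ := abs_sub_le _ _ _
      _ ≤ (H : ℝ) / m + (H : ℝ) ^ 2 / m := add_le_add hreplace hih
      _ ≤ _ := by
        rw [← add_div]
        gcongr
        push_cast
        nlinarith [Nat.cast_nonneg (α := ℝ) H]

lemma integral_inv {m : ℕ} (hm : 2 ≤ m) : ∫ ω, (hawkinsY (α ω) m)⁻¹ ∂μ = Mharm m := by
  have := h.isProb
  induction m, hm using Nat.le_induction with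
  | base => rw [h.integral_comp_two fun y => y⁻¹, Mharm_two, inv_one]
  | succ m hm ih =>
    have hm2 : (2 : ℝ) ≤ m := by exact_mod_cast hm
    have hm1 : (m : ℝ) - 1 ≠ 0 := by linarith
    rw [h.integral_comp_succ measurable_inv hm, Mharm_succ hm, ← ih]
    have e : ∀ ω, (hawkinsY (α ω) m)⁻¹ + hawkinsY (α ω) m *
        (((1 - 1 / (m : ℝ)) * hawkinsY (α ω) m)⁻¹ - (hawkinsY (α ω) m)⁻¹) =
        (hawkinsY (α ω) m)⁻¹ + 1 / ((m : ℝ) - 1) := fun ω => by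
      have := (h.pos m ω).ne'
      field_simp
      ring
    simp only [e]
    rw [integral_add (h.integrable_comp measurable_inv m) (integrable_const _)]
    simp

/-- The variance of `1 / y_m` is bounded. -/
lemma integral_inv_sq_le {m : ℕ} (hm : 2 ≤ m) :
    ∫ ω, (hawkinsY (α ω) m)⁻¹ ^ 2 ∂μ ≤ Mharm m ^ 2 + 4 - 2 * (Mharm m + 1) / (m - 1) := by
  have := h.isProb
  induction m, hm using Nat.le_induction with
  | base =>
    rw [h.integral_comp_two fun y => y⁻¹ ^ 2, Mharm_two]
    norm_num
  | succ m hm ih =>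
    have hm2 : (2 : ℝ) ≤ m := by exact_mod_cast hm
    obtain ⟨x, hx, hmx⟩ : ∃ x : ℝ, 1 ≤ x ∧ (m : ℝ) = x + 1 := ⟨m - 1, by linarith, by ring⟩
    have hx0 : 0 < x := by linarith
    have hms : Measurable fun y : ℝ => y⁻¹ ^ 2 := measurable_inv.pow_const 2
    rw [h.integral_comp_succ hms hm, Mharm_succ hm]
    have e : ∀ ω, (hawkinsY (α ω) m)⁻¹ ^ 2 + hawkinsY (α ω) m *
        (((1 - 1 / (m : ℝ)) * hawkinsY (α ω) m)⁻¹ ^ 2 - (hawkinsY (α ω) m)⁻¹ ^ 2) =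
        (hawkinsY (α ω) m)⁻¹ ^ 2 + (2 / x + 1 / x ^ 2) * (hawkinsY (α ω) m)⁻¹ := fun ω => by
      have := (h.pos m ω).ne'
      have h1 : 1 - 1 / (m : ℝ) = x / (x + 1) := by rw [hmx]; field_simp; ring
      rw [h1]
      field_simp
      ring
    simp only [e]
    rw [integral_add (h.integrable_comp hms m) ((h.integrable_comp measurable_inv m).const_mul _),
      integral_const_mul, h.integral_inv hm]
    push_cast
    rw [hmx] at ih ⊢
    simp only [add_sub_cancel_right] at ih ⊢
    have hM := one_le_Mharm m
    set M := Mharm m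
    have key : M ^ 2 + 4 - 2 * (M + 1) / x + (2 / x + 1 / x ^ 2) * M ≤
        (M + 1 / x) ^ 2 + 4 - 2 * (M + 1 / x + 1) / (x + 1) := by
      have : (M + 1 / x) ^ 2 + 4 - 2 * (M + 1 / x + 1) / (x + 1) -
          (M ^ 2 + 4 - 2 * (M + 1) / x + (2 / x + 1 / x ^ 2) * M) =
          (M * (x - 1) + (x + 1)) / (x ^ 2 * (x + 1)) := by
        field_simp
        ring
      have h2 : 0 ≤ (M * (x - 1) + (x + 1)) / (x ^ 2 * (x + 1)) := by
        have : 0 ≤ x - 1 := by linarith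
        positivity
      linarith
    linarith

lemma integral_sq_le {m : ℕ} (hm : 2 ≤ m) :
    ∫ ω, ((Mharm m)⁻¹ * (hawkinsY (α ω) m)⁻¹ - 1) ^ 2 ∂μ ≤ 4 * (Mharm m)⁻¹ ^ 2 := by
  have := h.isProb
  have hm2 : (2 : ℝ) ≤ m := by exact_mod_cast hm
  have hM := Mharm_pos m
  have h1 := h.integral_inv_sq_le hm
  have hms : Measurable fun y : ℝ => y⁻¹ ^ 2 := measurable_inv.pow_const 2
  have e : ∀ ω, ((Mharm m)⁻¹ * (hawkinsY (α ω) m)⁻¹ - 1) ^ 2 =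
      (Mharm m)⁻¹ ^ 2 * (hawkinsY (α ω) m)⁻¹ ^ 2 - 2 * (Mharm m)⁻¹ * (hawkinsY (α ω) m)⁻¹ + 1 :=
    fun ω => by ring
  have I1 : Integrable (fun ω => (Mharm m)⁻¹ ^ 2 * (hawkinsY (α ω) m)⁻¹ ^ 2) μ :=
    (h.integrable_comp hms m).const_mul _
  have I2 : Integrable (fun ω => 2 * (Mharm m)⁻¹ * (hawkinsY (α ω) m)⁻¹) μ :=
    (h.integrable_comp measurable_inv m).const_mul _
  have I12 : Integrable (fun ω => (Mharm m)⁻¹ ^ 2 * (hawkinsY (α ω) m)⁻¹ ^ 2 -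
      2 * (Mharm m)⁻¹ * (hawkinsY (α ω) m)⁻¹) μ := I1.sub I2
  simp only [e]
  rw [integral_add I12 (integrable_const _), integral_sub I1 I2, integral_const_mul,
    integral_const_mul, h.integral_inv hm]
  have h2 : 0 ≤ 2 * (Mharm m + 1) / ((m : ℝ) - 1) := by
    have : 0 ≤ (m : ℝ) - 1 := by linarith
    positivity
  have h3 := mul_le_mul_of_nonneg_left (h1.trans (sub_le_self _ h2))
    (show 0 ≤ (Mharm m)⁻¹ ^ 2 by positivity)
  have h4 : (Mharm m)⁻¹ ^ 2 * (Mharm m ^ 2 + 4) = 1 + 4 * (Mharm m)⁻¹ ^ 2 := by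
    field_simp
  have h5 : 2 * (Mharm m)⁻¹ * Mharm m = 2 := by field_simp
  rw [h4] at h3
  rw [h5]
  simp
  simp at h3
  linarith

lemma integrable_pow (p m : ℕ) : Integrable (fun ω => hawkinsY (α ω) m ^ p) μ :=
  h.integrable_comp (φ := fun y => y ^ p) (measurable_id.pow_const p) m

lemma integrable_scaled_inv (a : ℝ) (m : ℕ) :
    Integrable (fun ω => a * (hawkinsY (α ω) m)⁻¹ - 1) μ :=
  h.integrable_comp (φ := fun y => a * y⁻¹ - 1) ((measurable_inv.const_mul a).sub_const 1) m

lemma integral_scaled_inv {m : ℕ} (hm : 2 ≤ m) :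
    ∫ ω, ((Mharm m)⁻¹ * (hawkinsY (α ω) m)⁻¹ - 1) ∂μ = 0 := by
  have := h.isProb
  rw [integral_sub ((h.integrable_comp measurable_inv m).const_mul _) (integrable_const _),
    integral_const_mul, h.integral_inv hm, inv_mul_cancel₀ (Mharm_pos m).ne']
  simp

lemma integral_pow_succ (p : ℕ) {m : ℕ} (hm : 2 ≤ m) :
    ∫ ω, hawkinsY (α ω) (m + 1) ^ p ∂μ = ∫ ω, hawkinsY (α ω) m ^ p ∂μ -
      (1 - (1 - 1 / (m : ℝ)) ^ p) * ∫ ω, hawkinsY (α ω) m ^ (p + 1) ∂μ := by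
  rw [h.integral_comp_succ (φ := fun y => y ^ p) (measurable_id.pow_const p) hm,
    ← integral_const_mul, ← integral_sub (h.integrable_pow p m)
      ((h.integrable_pow (p + 1) m).const_mul _)]
  congr 1
  ext ω
  rw [mul_pow]
  ring

lemma inv_Mharm_pow_le_integral_pow (p : ℕ) {m : ℕ} (hm : 2 ≤ m) :
    (Mharm m)⁻¹ ^ p ≤ ∫ ω, hawkinsY (α ω) m ^ p ∂μ := by
  have := h.isProb
  have ht : 0 < (Mharm m)⁻¹ := inv_pos.2 (Mharm_pos m)
  set t := (Mharm m)⁻¹ with htdef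
  have hpt : ∀ ω, t ^ p * (1 - p * (t * (hawkinsY (α ω) m)⁻¹ - 1)) ≤ hawkinsY (α ω) m ^ p := by
    intro ω
    have hu : 0 < hawkinsY (α ω) m / t := div_pos (h.pos m ω) ht
    have k := pow_eq_add_invRem p hu.ne'
    rw [show (hawkinsY (α ω) m / t)⁻¹ = t * (hawkinsY (α ω) m)⁻¹ by
      rw [inv_div, div_eq_mul_inv]] at k
    have hR := mul_nonneg (sq_nonneg (t * (hawkinsY (α ω) m)⁻¹ - 1)) (invRem_nonneg p hu.le)
    have e : hawkinsY (α ω) m ^ p = t ^ p * (hawkinsY (α ω) m / t) ^ p := by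
      rw [← mul_pow, mul_div_cancel₀ _ ht.ne']
    rw [e]
    exact mul_le_mul_of_nonneg_left (by linarith) (by positivity)
  have hI := (h.integrable_scaled_inv t m).const_mul (p : ℝ)
  have := integral_mono (((integrable_const (1 : ℝ)).sub hI).const_mul (t ^ p))
    (h.integrable_pow p m) hpt
  simp only [Pi.sub_apply] at this
  rw [integral_const_mul, integral_sub (integrable_const _) hI, integral_const_mul,
    h.integral_scaled_inv hm] at this
  simpa using this

lemma le_integral_pow_succ (p : ℕ) {A : ℝ} (hA : 0 ≤ A) {m : ℕ} (hm : 2 ≤ m) :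
    A * (Mharm m)⁻¹ * ∫ ω, hawkinsY (α ω) m ^ p ∂μ - (A - 1) * (Mharm m)⁻¹ ^ (p + 1) -
      4 * (A * invRem p A) * (Mharm m)⁻¹ ^ (p + 3) ≤ ∫ ω, hawkinsY (α ω) m ^ (p + 1) ∂μ := by
  have := h.isProb
  have ht : 0 < (Mharm m)⁻¹ := inv_pos.2 (Mharm_pos m)
  have hvar := h.integral_sq_le hm
  have hmean := h.integral_scaled_inv hm
  set t := (Mharm m)⁻¹ with htdef
  have I1 := (h.integrable_scaled_inv t m).const_mul ((p : ℝ) + 1 - A * p)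
  have I01 : Integrable (fun ω => A - 1 +
      ((p : ℝ) + 1 - A * p) * (t * (hawkinsY (α ω) m)⁻¹ - 1)) μ := (integrable_const _).add I1
  have I2 : Integrable (fun ω => A * invRem p A * (t * (hawkinsY (α ω) m)⁻¹ - 1) ^ 2) μ :=
    h.integrable_comp (φ := fun y => A * invRem p A * (t * y⁻¹ - 1) ^ 2)
      ((((measurable_inv.const_mul t).sub_const 1).pow_const 2).const_mul _) m
  have I3 := (h.integrable_pow p m).const_mul (A * t)
  have key := integral_mono (I3.sub (h.integrable_pow (p + 1) m))
    ((I01.add I2).const_mul (t ^ (p + 1)))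
    fun ω => mul_pow_sub_pow_succ_le p hA ht (h.pos m ω)
  simp only [Pi.sub_apply, Pi.add_apply] at key
  rw [integral_sub I3 (h.integrable_pow (p + 1) m), integral_const_mul, integral_const_mul,
    integral_add I01 I2, integral_add (integrable_const _) I1,
    integral_const_mul, integral_const_mul, hmean] at key
  have hE : 0 ≤ A * invRem p A := mul_nonneg hA (invRem_nonneg p hA)
  have h3 := mul_le_mul_of_nonneg_left (mul_le_mul_of_nonneg_left hvar hE)
    (show 0 ≤ t ^ (p + 1) by positivity)
  have e : t ^ (p + 1) * (A * invRem p A * (4 * t ^ 2)) =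
    4 * (A * invRem p A) * t ^ (p + 3) := by ring
  rw [e] at h3
  simp only [integral_const, probReal_univ, smul_eq_mul, one_mul, mul_zero, add_zero] at key
  linarith

/-- The upper half of `𝔼 (y_m ^ p) = M_m⁻ᵖ + O(M_m⁻ᵖ⁻²)`. -/
lemma exists_integral_pow_le {p : ℕ} (hp : 1 ≤ p) : ∃ C : ℝ, ∀ᶠ m : ℕ in atTop,
    ∫ ω, hawkinsY (α ω) m ^ p ∂μ ≤ (Mharm m)⁻¹ ^ p + C * (Mharm m)⁻¹ ^ (p + 2) := by
  have := h.isProb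
  obtain ⟨K, hK, hKm⟩ := exists_Mharm_pow_le 2
  set A : ℝ := 2 * (p + 3) with hA
  have hA0 : 0 ≤ A := by positivity
  set E : ℝ := 4 * (A * invRem p A) with hE
  have hE0 : 0 ≤ E := by have := invRem_nonneg p hA0; positivity
  set m₀ : ℕ := 2 * p * (p + 3) + 2 with hm₀
  set C : ℝ := max ((p + p ^ 2) * (2 * K) + p * E) (Mharm m₀ ^ (p + 2)) with hC
  have hC0 : 0 ≤ C := le_max_of_le_right (by have := Mharm_pos m₀; positivity)
  refine ⟨C, eventually_atTop.2 ⟨m₀, fun m hm => ?_⟩⟩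
  induction m, hm using Nat.le_induction with
  | base =>
    have hM := Mharm_pos m₀
    have h1 : ∫ ω, hawkinsY (α ω) m₀ ^ p ∂μ ≤ 1 := by
      have := integral_mono (h.integrable_pow p m₀) (integrable_const (1 : ℝ))
        fun ω => pow_le_one₀ (h.pos m₀ ω).le (h.le_one m₀ ω)
      simpa using this
    have h2 : 1 ≤ C * (Mharm m₀)⁻¹ ^ (p + 2) := by
      rw [inv_pow, ← div_eq_mul_inv, one_le_div (by positivity)]
      exact le_max_right _ _
    have h3 : 0 ≤ (Mharm m₀)⁻¹ ^ p := by positivity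
    linarith
  | succ m hm ih =>
    have hm2 : 2 ≤ m := by omega
    have hmR : (2 : ℝ) * p * (p + 3) + 2 ≤ m := by exact_mod_cast hm
    have hp1 : (1 : ℝ) ≤ p := by exact_mod_cast hp
    have hm2R : (2 : ℝ) ≤ m := by exact_mod_cast hm2
    have hM := Mharm_pos m
    have hM1 := one_le_Mharm m
    have hlow := h.le_integral_pow_succ p hA0 hm2
    rw [h.integral_pow_succ p hm2, Mharm_succ hm2]
    set s : ℝ := 1 / ((m : ℝ) - 1) with hs
    set x : ℝ := 1 / (m : ℝ) with hx
    have hs0 : 0 < s := by rw [hs]; exact one_div_pos.2 (by linarith)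
    have hx0 : 0 < x := by positivity
    have hxs : x = s - x * s := by
      have : (m : ℝ) - 1 ≠ 0 := by linarith
      rw [hx, hs]; field_simp
    have hx1 : x ≤ 1 / 2 := one_div_le_one_div_of_le (by norm_num) hm2R
    obtain ⟨hc1, hc2, hc3⟩ := one_sub_one_sub_pow_bounds hp hx0 hx1 hxs
    set c : ℝ := 1 - (1 - x) ^ p with hc
    have hs2 : s ≤ 2 * K * (Mharm m)⁻¹ ^ 2 := by
      have h1 := hKm m (by omega)
      rw [inv_pow, ← div_eq_mul_inv, le_div_iff₀ (by positivity), hs, one_div,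
        inv_mul_le_iff₀ (by linarith)]
      nlinarith
    have hb1 := (inv_add_pow_bounds p hM hs0.le).1
    have hb2 := (inv_add_pow_bounds (p + 2) hM hs0.le).1
    have ht0 : 0 < (Mharm m)⁻¹ := inv_pos.2 hM
    have ht1 : (Mharm m)⁻¹ ≤ 1 := inv_le_one_of_one_le₀ hM1
    set t := (Mharm m)⁻¹ with htdef
    set a := ∫ ω, hawkinsY (α ω) m ^ p ∂μ
    set a₁ := ∫ ω, hawkinsY (α ω) m ^ (p + 1) ∂μ
    have hcA : c * A * t ≤ 1 := by
      have h1 : p * s * A ≤ 1 := by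
        rw [hs, hA, mul_one_div, div_mul_eq_mul_div, div_le_one (by linarith)]
        nlinarith
      have h2 : c * A ≤ 1 := (mul_le_mul_of_nonneg_right hc2 hA0).trans h1
      exact mul_le_one₀ h2 ht0.le ht1
    have hstep := moment_step_le hA hC0 (le_max_left _ _) hE0 hs0 ht0 hs2 hc1 hc2 hc3 hcA ih hlow
    have hC' := mul_le_mul_of_nonneg_left hb2 hC0
    push_cast at hC'
    linarith

lemma integral_pow_sub_isBigO {p : ℕ} (hp : 1 ≤ p) :
    (fun m : ℕ => ∫ ω, hawkinsY (α ω) m ^ p ∂μ - (Mharm m)⁻¹ ^ p) =O[atTop]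
      fun m : ℕ => (Mharm m)⁻¹ ^ (p + 2) := by
  obtain ⟨C, hC⟩ := h.exists_integral_pow_le hp
  refine IsBigO.of_bound C ?_
  filter_upwards [hC, eventually_ge_atTop 2] with m h1 h2
  have h3 := h.inv_Mharm_pow_le_integral_pow p h2
  have h4 := inv_pos.2 (Mharm_pos m)
  rw [Real.norm_eq_abs, Real.norm_eq_abs, abs_of_nonneg (by linarith),
    abs_of_nonneg (by positivity)]
  linarith

lemma integral_pow_isBigO {p : ℕ} (hp : 1 ≤ p) :
    (fun m : ℕ => ∫ ω, hawkinsY (α ω) m ^ p ∂μ) =O[atTop] fun m : ℕ => (Mharm m)⁻¹ ^ p := by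
  have h1 := (h.integral_pow_sub_isBigO hp).trans (inv_Mharm_pow_isBigO (Nat.le_add_right p 2))
  simpa using h1.add (isBigO_refl _ _)

/-- The asymptotics of the mean of `y ^ p (1 - y) ^ b`, to second order. -/
lemma integral_pow_mul_one_sub_pow_isBigO {p : ℕ} (hp : 1 ≤ p) (b : ℕ) :
    (fun m : ℕ => ∫ ω, hawkinsY (α ω) m ^ p * (1 - hawkinsY (α ω) m) ^ b ∂μ -
        ((Mharm m)⁻¹ ^ p - b * (Mharm m)⁻¹ ^ (p + 1))) =O[atTop]
      fun m : ℕ => (Mharm m)⁻¹ ^ (p + 2) := by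
  have hfirst : (fun m : ℕ => ∫ ω, hawkinsY (α ω) m ^ p * (1 - hawkinsY (α ω) m) ^ b ∂μ -
      (∫ ω, hawkinsY (α ω) m ^ p ∂μ - b * ∫ ω, hawkinsY (α ω) m ^ (p + 1) ∂μ)) =O[atTop]
      fun m : ℕ => ∫ ω, hawkinsY (α ω) m ^ (p + 2) ∂μ := by
    refine IsBigO.of_bound ((b : ℝ) ^ 2) (Eventually.of_forall fun m => ?_)
    have I0 : Integrable (fun ω => hawkinsY (α ω) m ^ p * (1 - hawkinsY (α ω) m) ^ b) μ :=
      h.integrable_comp (φ := fun y => y ^ p * (1 - y) ^ b)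
        ((measurable_id.pow_const p).mul ((measurable_id.const_sub 1).pow_const b)) m
    have I1 := (h.integrable_pow (p + 1) m).const_mul (b : ℝ)
    have I2 : Integrable (fun ω => hawkinsY (α ω) m ^ p - b * hawkinsY (α ω) m ^ (p + 1)) μ :=
      (h.integrable_pow p m).sub I1
    rw [← integral_const_mul, ← integral_sub (h.integrable_pow p m) I1, ← integral_sub I0 I2,
      Real.norm_of_nonneg (integral_nonneg fun ω => pow_nonneg (h.pos m ω).le (p + 2)),
      ← integral_const_mul]
    refine norm_integral_le_of_norm_le ((h.integrable_pow (p + 2) m).const_mul _)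
      (ae_of_all _ fun ω => ?_)
    have hy0 := h.pos m ω
    have hy1 := h.le_one m ω
    set y := hawkinsY (α ω) m
    have u1 := one_sub_pow_le b hy0.le hy1
    have u2 := one_add_mul_le_pow (show (-2 : ℝ) ≤ -y by linarith) b
    rw [← sub_eq_add_neg] at u2
    have e : y ^ p * (1 - y) ^ b - (y ^ p - b * y ^ (p + 1)) =
      y ^ p * ((1 - y) ^ b - (1 - b * y)) := by ring
    have e2 : (b : ℝ) ^ 2 * y ^ (p + 2) = y ^ p * (b ^ 2 * y ^ 2) := by ring
    rw [e, e2, Real.norm_of_nonneg (mul_nonneg (by positivity) (by linarith))]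
    exact mul_le_mul_of_nonneg_left (by linarith) (by positivity)
  have h1 := hfirst.trans (h.integral_pow_isBigO (p := p + 2) (by omega))
  have h2 := h.integral_pow_sub_isBigO hp
  have h3 := (((h.integral_pow_sub_isBigO (p := p + 1) (by omega)).trans
    (inv_Mharm_pow_isBigO (show p + 2 ≤ p + 1 + 2 by omega))).const_mul_left (b : ℝ))
  refine ((h1.add h2).sub h3).congr_left fun m => ?_
  ring

/-- The asymptotic probability of a membership pattern on a block of length `H`. -/
lemma integral_prod_memInd_isBigO (P : ℕ → Prop) (H : ℕ) {p b : ℕ} (hp : 1 ≤ p)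
    (hcard : ((Finset.range H).filter P).card = p)
    (hcard' : ((Finset.range H).filter fun d => ¬ P d).card = b) :
    (fun m : ℕ => ∫ ω, ∏ d ∈ Finset.range H,
        (if P d then memInd α (m + d) ω else 1 - memInd α (m + d) ω) ∂μ -
        ((Mharm m)⁻¹ ^ p - b * (Mharm m)⁻¹ ^ (p + 1))) =O[atTop]
      fun m : ℕ => (Mharm m)⁻¹ ^ (p + 2) := by
  obtain ⟨K, hK, hKm⟩ := exists_Mharm_pow_le (p + 2)
  have h1 : (fun m : ℕ => ∫ ω, ∏ d ∈ Finset.range H,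
        (if P d then memInd α (m + d) ω else 1 - memInd α (m + d) ω) ∂μ -
        ∫ ω, hawkinsY (α ω) m ^ p * (1 - hawkinsY (α ω) m) ^ b ∂μ) =O[atTop]
      fun m : ℕ => (Mharm m)⁻¹ ^ (p + 2) := by
    refine IsBigO.of_bound ((H : ℝ) ^ 2 * K) ?_
    filter_upwards [eventually_ge_atTop 2] with m hm
    have key := h.abs_integral_mul_prod_sub_le P hm H (g := fun _ => 1) measurable_const (by simp)
    simp only [one_mul] at key
    have e : ∀ ω, ∏ d ∈ Finset.range H,
        (if P d then hawkinsY (α ω) m else 1 - hawkinsY (α ω) m) =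
        hawkinsY (α ω) m ^ p * (1 - hawkinsY (α ω) m) ^ b := fun ω => by
      rw [Finset.prod_ite, Finset.prod_const, Finset.prod_const, hcard, hcard']
    simp only [e] at key
    have hM := Mharm_pos m
    have hm0 : (0 : ℝ) < m := by exact_mod_cast (by omega : 0 < m)
    rw [Real.norm_eq_abs, Real.norm_of_nonneg (by positivity)]
    refine key.trans ?_
    rw [inv_pow, ← div_eq_mul_inv, div_le_div_iff₀ hm0 (by positivity), mul_assoc]
    exact mul_le_mul_of_nonneg_left (hKm m (by omega)) (by positivity)
  refine (h1.add (h.integral_pow_mul_one_sub_pow_isBigO hp b)).congr_left fun m => ?_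
  ring

lemma integrable_prod_memInd (P : ℕ → Prop) (H m : ℕ) :
    Integrable (fun ω => ∏ d ∈ Finset.range H,
      (if P d then memInd α (m + d) ω else 1 - memInd α (m + d) ω)) μ := by
  have := h.isProb
  refine .of_bound (C := 1) (Measurable.aestronglyMeasurable ?_) (ae_of_all _ fun ω => ?_)
  · refine Finset.measurable_fun_prod _ fun d _ => ?_
    have := (h.measurable_memInd (Nat.lt_succ_self (m + d))).mono (h.sieveSigma_le _) le_rfl
    split_ifs
    · exact this
    · exact measurable_const.sub this
  · rw [Real.norm_eq_abs, Finset.abs_prod]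
    refine Finset.prod_le_one (fun _ _ => abs_nonneg _) fun d _ => ?_
    unfold memInd
    split_ifs <;> simp

lemma integral_hawkinsT {l k : ℕ} {i : ℕ → ℕ} {P : ℕ → Prop}
    (hP : ∀ d, P d ↔ ∃ j, j ≤ l + 1 ∧ i j = d) (n : ℕ) :
    ∫ ω, (hawkinsT (α ω) l k i n : ℝ) ∂μ = ∑ m ∈ Finset.range (n + 1),
      ∫ ω, ∏ d ∈ Finset.range (k + 1),
        (if P d then memInd α (m + d) ω else 1 - memInd α (m + d) ω) ∂μ := by
  rw [← integral_finsetSum _ fun m _ => h.integrable_prod_memInd P (k + 1) m]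
  congr 1
  ext ω
  rw [hawkinsT, Finset.card_filter]
  push_cast
  refine Finset.sum_congr rfl fun m _ => ?_
  have e : ∀ d, (if P d then memInd α (m + d) ω else 1 - memInd α (m + d) ω) =
      if (m + d ∈ α ω ↔ P d) then 1 else 0 := fun d => by
    by_cases h1 : P d <;> by_cases h2 : m + d ∈ α ω <;> simp [memInd, h1, h2]
  simp only [e, Finset.prod_boole]
  congr 1
  simp [patMem, hP]

end IsHawkinsSieve
end Sieve

/-- The number of positions of the block `[0, k]` that lie in the pattern. -/
lemma card_filter_pattern {l k : ℕ} {i : ℕ → ℕ} {P : ℕ → Prop}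
    (hP : ∀ d, P d ↔ ∃ j, j ≤ l + 1 ∧ i j = d) (hlast : i (l + 1) = k)
    (hmono : ∀ j : ℕ, j ≤ l → i j < i (j + 1)) :
    ((Finset.range (k + 1)).filter P).card = l + 2 := by
  have hlt : ∀ b, b ≤ l + 1 → ∀ a, a < b → i a < i b := by
    intro b
    induction b with
    | zero => intro _ a ha; omega
    | succ b ih =>
      intro hb a ha
      have h1 := hmono b (by omega)
      rcases (Nat.lt_succ_iff_lt_or_eq.1 ha) with h2 | rfl
      · exact (ih (by omega) a h2).trans h1
      · exact h1
  have himage : ((Finset.range (k + 1)).filter P) =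
      (Finset.range (l + 2)).image i := by
    ext d
    simp only [Finset.mem_filter, Finset.mem_range, Finset.mem_image, hP]
    constructor
    · rintro ⟨-, j, hj, rfl⟩
      exact ⟨j, by omega, rfl⟩
    · rintro ⟨j, hj, rfl⟩
      refine ⟨?_, j, by omega, rfl⟩
      rcases (Nat.lt_or_ge j (l + 1)) with h1 | h1
      · have := hlt (l + 1) le_rfl j h1
        omega
      · rw [show j = l + 1 by omega]
        omega
  rw [himage, Finset.card_image_of_injOn, Finset.card_range]
  intro a ha b hb hab
  simp only [Finset.coe_range, Set.mem_Iio] at ha hb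
  by_contra hne
  rcases Nat.lt_or_gt_of_ne hne with h1 | h1
  · exact (hlt b (by omega) a h1).ne hab
  · exact (hlt a (by omega) b h1).ne' hab

theorem hawkinsT_expectation (l k : ℕ) (i : ℕ → ℕ) (h0 : i 0 = 0)
    (hlast : i (l + 1) = k) (hmono : ∀ j : ℕ, j ≤ l → i j < i (j + 1))
    {Ω : Type*} [MeasurableSpace Ω] (μ : Measure Ω) (α : Ω → Set ℕ)
    (h : IsHawkinsSieve μ α) :
    (fun n : ℕ =>
        (∫ ω, (hawkinsT (α ω) l k i n : ℝ) ∂μ) -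
          ((n : ℝ) / (Mharm n) ^ (l + 2) -
            ((k : ℝ) - 2 * l - 3) * (n : ℝ) / (Mharm n) ^ (l + 3)))
      =O[atTop] fun n : ℕ => (n : ℝ) / (Mharm n) ^ (l + 4) := by
  obtain ⟨P, hP⟩ : ∃ P : ℕ → Prop, ∀ d, P d ↔ ∃ j, j ≤ l + 1 ∧ i j = d := ⟨_, fun _ => Iff.rfl⟩
  have hcard := card_filter_pattern hP hlast hmono
  obtain ⟨b, hb⟩ : ∃ b, ((Finset.range (k + 1)).filter fun d => ¬ P d).card = b := ⟨_, rfl⟩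
  have hbk : (b : ℝ) = k - l - 1 := by
    have := Finset.card_filter_add_card_filter_not (s := Finset.range (k + 1)) P
    rw [hcard, hb, Finset.card_range] at this
    have : (l : ℝ) + 2 + b = k + 1 := by exact_mod_cast this
    linarith
  have hpat := h.integral_prod_memInd_isBigO P (k + 1) (by omega) hcard hb
  have hshift : ∀ r, l + 2 ≤ r → (fun n : ℕ => (Mharm (n + 1))⁻¹ ^ r - (Mharm n)⁻¹ ^ r) =O[atTop]
      fun n : ℕ => (Mharm n)⁻¹ ^ (l + 4) := fun r hr =>
    (inv_Mharm_succ_pow_sub_isBigO r).trans (inv_Mharm_pow_isBigO (by omega))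
  have hpat' : (fun n : ℕ => ∫ ω, ∏ d ∈ Finset.range (k + 1),
        (if P d then memInd α (n + 1 + d) ω else 1 - memInd α (n + 1 + d) ω) ∂μ -
        ((Mharm (n + 1))⁻¹ ^ (l + 2) - b * (Mharm (n + 1))⁻¹ ^ (l + 3))) =O[atTop]
      fun n : ℕ => (Mharm n)⁻¹ ^ (l + 4) := by
    refine (hpat.comp_tendsto (tendsto_add_atTop_nat 1)).trans ?_
    simpa [Function.comp_def] using (hshift (l + 4) (by omega)).add (isBigO_refl _ _)
  have hmain : (fun n : ℕ => (∫ ω, (hawkinsT (α ω) l k i n : ℝ) ∂μ) -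
      ((n : ℝ) * (Mharm n)⁻¹ ^ (l + 2) -
        ((k : ℝ) - 2 * l - 3) * ((n : ℝ) * (Mharm n)⁻¹ ^ (l + 3)))) =O[atTop]
      fun n : ℕ => (n : ℝ) * (Mharm n)⁻¹ ^ (l + 4) := by
    refine isBigO_of_succ_sub_isBigO (l + 4) ?_
    have h1 := mul_inv_Mharm_pow_succ_sub_isBigO (l + 2)
    have h2 := ((mul_inv_Mharm_pow_succ_sub_isBigO (l + 3)).trans
      (inv_Mharm_pow_isBigO (show l + 4 ≤ l + 3 + 2 by omega))).const_mul_left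
        ((k : ℝ) - 2 * l - 3)
    have h3 := hshift (l + 2) le_rfl
    have h4 := (hshift (l + 3) (by omega)).const_mul_left (b : ℝ)
    have h5 := (inv_Mharm_pow_isBigO (le_refl (l + 4))).const_mul_left
      (-(((k : ℝ) - 2 * l - 3) * (l + 3)))
    refine (((((hpat'.add h3).sub h4).sub h1).add h2).add h5).congr_left fun n => ?_
    rw [h.integral_hawkinsT hP (n + 1), h.integral_hawkinsT hP n,
      Finset.sum_range_succ _ (n + 1), hbk]
    push_cast
    ring
  refine hmain.congr (fun n => ?_) fun n => ?_
  · simp only [inv_pow, div_eq_mul_inv]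
    ring
  · rw [inv_pow, div_eq_mul_inv]
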